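/- Let V be a nonempty finite type and k ≥ 1. Let P be a probability mass function on V^k with marginals P_t. Then TV(P, ⊗_{t=1}^{k} P_t) ≤ Σ_{t=2}^{k} Σ_{y_{<t}} P(y_{<t}) · TV(P(· | y_{<t}), P_t); that is, the total variation distance between the joint distribution and the product of its marginals is at most the sum over positions t = 2, …, k of the expected (over histories drawn from P) total variation distance between the conditional distribution of the t-th coordinate given the first t−1 coordinates and its marginal. -/

import Mathlib

open Finset

/-- Total variation distance between two mass functions on a finite type:
`TV(p, q) = (1/2) ∑ₓ |p x - q x|`. -/
noncomputable def tv {X : Type*} [Fintype X] (p q : X → ℝ) : ℝ :=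
  (1 / 2) * ∑ x, |p x - q x|

/-- The `t`-th marginal of a mass function `P` on `Fin k → V`. -/
noncomputable def marg {V : Type*} [Fintype V] [DecidableEq V] {k : ℕ}
    (P : (Fin k → V) → ℝ) (t : Fin k) (v : V) : ℝ :=
  ∑ y : Fin k → V, if y t = v then P y else 0

/-- Probability under `P` that the first `t` coordinates agree with those of `z`. -/
noncomputable def prefProb {V : Type*} [Fintype V] [DecidableEq V] {k : ℕ}
    (P : (Fin k → V) → ℝ) (t : ℕ) (z : Fin k → V) : ℝ :=
  ∑ y : Fin k → V, if ∀ i : Fin k, (i : ℕ) < t → y i = z i then P y else 0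

/-- Conditional distribution of coordinate `t` given that the coordinates before `t`
equal those of `z` (Lean's division-by-zero convention handles zero-probability
histories, which are anyway weighted by zero below). -/
noncomputable def condD {V : Type*} [Fintype V] [DecidableEq V] {k : ℕ}
    (P : (Fin k → V) → ℝ) (t : Fin k) (z : Fin k → V) (v : V) : ℝ :=
  prefProb P ((t : ℕ) + 1) (Function.update z t v) / prefProb P (t : ℕ) z

/-- Extend a history on the first `t` coordinates to a full configuration. -/
noncomputable def extendHist {V : Type*} [Nonempty V] {k t : ℕ}
    (h : Fin t → V) : Fin k → V :=
  fun i => if hi : (i : ℕ) < t then h ⟨i, hi⟩ else Classical.arbitrary V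

/-- Expectation, over histories `Y_{<t}` drawn from `P`, of the total variation
distance between the conditional distribution of the `t`-th coordinate given the
history and the `t`-th marginal. -/
noncomputable def expCondTV {V : Type*} [Fintype V] [DecidableEq V] [Nonempty V] {k : ℕ}
    (P : (Fin k → V) → ℝ) (t : Fin k) : ℝ :=
  ∑ h : Fin (t : ℕ) → V,
    prefProb P (t : ℕ) (extendHist h) * tv (condD P t (extendHist h)) (marg P t)

/-- Averaging a function of the first `s` coordinates against independent mass functions on the
remaining coordinates leaves the sum over histories. -/
theorem sum_mul_prod_tail {V : Type*} [Fintype V] [DecidableEq V] [Nonempty V] {k s : ℕ}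
    (hs : s ≤ k) (m : Fin k → V → ℝ) (hm : ∀ i, ∑ v, m i v = 1) (G : (Fin k → V) → ℝ)
    (hG : ∀ y z : Fin k → V, (∀ i : Fin k, (i : ℕ) < s → y i = z i) → G y = G z) :
    ∑ y, G y * ∏ i ∈ univ.filter (fun i : Fin k => ¬ (i : ℕ) < s), m i (y i) =
      ∑ h : Fin s → V, G (extendHist h) := by
  let e : {i : Fin k // (i : ℕ) < s} ≃ Fin s :=
    { toFun := fun i => ⟨i.1, i.2⟩
      invFun := fun j => ⟨⟨j, j.2.trans_le hs⟩, j.2⟩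
      left_inv := fun _ => rfl
      right_inv := fun _ => rfl }
  rw [← (Equiv.piEquivPiSubtypeProd (fun i : Fin k => (i : ℕ) < s) (fun _ => V)).symm.sum_comp,
    Fintype.sum_prod_type]
  refine Fintype.sum_equiv (Equiv.arrowCongr e (Equiv.refl V)) _ _ fun a => ?_
  have hone : ∑ b : {i : Fin k // ¬ (i : ℕ) < s} → V, ∏ i, m i.1 (b i) = 1 := by
    have := Finset.prod_univ_sum (fun _ : {i : Fin k // ¬ (i : ℕ) < s} => (univ : Finset V))
      (fun i v => m i.1 v)
    rw [Fintype.piFinset_univ] at this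
    rw [← this]
    exact Finset.prod_eq_one fun i _ => hm i.1
  rw [← mul_one (G _), ← hone, Finset.mul_sum]
  refine Finset.sum_congr rfl fun b _ => ?_
  congr 1
  · refine hG _ _ fun i hi => ?_
    simp [Equiv.piEquivPiSubtypeProd, extendHist, hi, e]
  · rw [Finset.prod_subtype (p := fun i : Fin k => ¬ (i : ℕ) < s) _ (by simp)]
    refine Finset.prod_congr rfl fun i _ => ?_
    simp [Equiv.piEquivPiSubtypeProd, i.2]

theorem extendHist_snoc {V : Type*} [Nonempty V] {k : ℕ} (t : Fin k) (h : Fin (t : ℕ) → V)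
    (v : V) :
    (extendHist (Fin.snoc h v : Fin ((t : ℕ) + 1) → V) : Fin k → V) =
      Function.update (extendHist h) t v := by
  funext i
  rcases lt_trichotomy (i : ℕ) t with hi | hi | hi
  · have hne : i ≠ t := fun hit => by simp [hit] at hi
    simp [extendHist, hne, hi, Nat.lt_succ_of_lt hi, Fin.snoc]
  · obtain rfl : i = t := Fin.ext hi
    simp [extendHist, Fin.snoc]
  · have hne : i ≠ t := fun hit => by simp [hit] at hi
    simp [extendHist, hne, hi.not_gt, show ¬ (i : ℕ) < t + 1 by omega]

section MassFunction

variable {V : Type*} [Fintype V] [DecidableEq V] {k : ℕ} {P : (Fin k → V) → ℝ}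

theorem sum_marg (P : (Fin k → V) → ℝ) (t : Fin k) : ∑ v, marg P t v = ∑ y, P y := by
  unfold marg
  rw [Finset.sum_comm]
  simp

theorem marg_nonneg (hP0 : ∀ y, 0 ≤ P y) (t : Fin k) (v : V) : 0 ≤ marg P t v :=
  Finset.sum_nonneg fun y _ => by split_ifs <;> simp [hP0]

theorem prefProb_nonneg (hP0 : ∀ y, 0 ≤ P y) (t : ℕ) (z : Fin k → V) : 0 ≤ prefProb P t z :=
  Finset.sum_nonneg fun y _ => by split_ifs <;> simp [hP0]

theorem prefProb_congr (P : (Fin k → V) → ℝ) {t : ℕ} {y z : Fin k → V}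
    (h : ∀ i : Fin k, (i : ℕ) < t → y i = z i) : prefProb P t y = prefProb P t z := by
  refine Finset.sum_congr rfl fun x _ => ?_
  congr 1
  exact propext (forall_congr' fun i => forall_congr' fun hi => by rw [h i hi])

theorem prefProb_succ_le (hP0 : ∀ y, 0 ≤ P y) (t : ℕ) (z : Fin k → V) :
    prefProb P (t + 1) z ≤ prefProb P t z := by
  refine Finset.sum_le_sum fun y _ => ?_
  by_cases h : ∀ i : Fin k, (i : ℕ) < t + 1 → y i = z i
  · rw [if_pos h, if_pos fun i hi => h i (Nat.lt_succ_of_lt hi)]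
  · rw [if_neg h]
    split_ifs <;> simp [hP0]

theorem prefProb_length (P : (Fin k → V) → ℝ) (z : Fin k → V) : prefProb P k z = P z := by
  simp [prefProb, ← funext_iff]

theorem prefProb_one (P : (Fin k → V) → ℝ) (hk : 0 < k) (z : Fin k → V) :
    prefProb P 1 z = marg P ⟨0, hk⟩ (z ⟨0, hk⟩) := by
  refine Finset.sum_congr rfl fun y _ => ?_
  congr 1
  refine propext ⟨fun h => h _ Nat.zero_lt_one, fun h i hi => ?_⟩
  obtain rfl : i = ⟨0, hk⟩ := Fin.ext (by simpa using hi)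
  exact h

theorem prefProb_mul_tv_condD (hP0 : ∀ y, 0 ≤ P y) (t : Fin k) (z : Fin k → V) :
    prefProb P t z * tv (condD P t z) (marg P t) =
      (1 / 2) * ∑ v, |prefProb P ((t : ℕ) + 1) (Function.update z t v) -
        prefProb P t z * marg P t v| := by
  unfold tv
  rw [mul_left_comm, Finset.mul_sum]
  congr 1
  refine Finset.sum_congr rfl fun v _ => ?_
  have hupd : prefProb P t (Function.update z t v) = prefProb P t z :=
    prefProb_congr P fun i hi =>
      Function.update_of_ne (fun hit => by simp [hit] at hi) _ _
  have hle := prefProb_succ_le hP0 t (Function.update z t v)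
  have hnn := prefProb_nonneg hP0 (t + 1) (Function.update z t v)
  rw [hupd] at hle
  by_cases h0 : prefProb P t z = 0
  · have : prefProb P ((t : ℕ) + 1) (Function.update z t v) = 0 := by linarith
    simp [h0, this]
  · rw [← abs_of_nonneg (prefProb_nonneg hP0 t z), ← abs_mul,
      abs_of_nonneg (prefProb_nonneg hP0 t z), mul_sub, condD, mul_div_cancel₀ _ h0]

/-- The hybrid mass function: the first `s` coordinates follow `P`, and the others follow
their marginals independently. -/
noncomputable def hybrid (P : (Fin k → V) → ℝ) (s : ℕ) (y : Fin k → V) : ℝ :=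
  prefProb P s y * ∏ i ∈ univ.filter (fun i : Fin k => ¬ (i : ℕ) < s), marg P i (y i)

theorem filter_not_lt_eq_insert (t : Fin k) :
    univ.filter (fun i : Fin k => ¬ (i : ℕ) < t) =
      insert t (univ.filter fun i : Fin k => ¬ (i : ℕ) < t + 1) := by
  ext i
  simp only [mem_filter, mem_univ, true_and, mem_insert, Fin.ext_iff]
  omega

theorem hybrid_eq (P : (Fin k → V) → ℝ) (t : Fin k) (y : Fin k → V) :
    hybrid P t y = prefProb P t y * marg P t (y t) *
      ∏ i ∈ univ.filter (fun i : Fin k => ¬ (i : ℕ) < t + 1), marg P i (y i) := by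
  rw [hybrid, filter_not_lt_eq_insert, Finset.prod_insert (by simp), mul_assoc]

theorem hybrid_length (P : (Fin k → V) → ℝ) : hybrid P k = P := by
  funext y
  simp [hybrid, prefProb_length]

theorem hybrid_one (P : (Fin k → V) → ℝ) (hk : 0 < k) :
    hybrid P 1 = fun y => ∏ t, marg P t (y t) := by
  funext y
  have h := filter_not_lt_eq_insert (⟨0, hk⟩ : Fin k)
  simp only [Nat.not_lt_zero, not_false_eq_true, filter_true, zero_add] at h
  rw [hybrid, prefProb_one P hk]
  conv_rhs => rw [h, Finset.prod_insert (by simp)]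

/-- Consecutive hybrids differ in total variation by the expected conditional total variation. -/
theorem tv_hybrid_succ [Nonempty V] (hP0 : ∀ y, 0 ≤ P y) (hP1 : ∑ y, P y = 1) (t : Fin k) :
    tv (hybrid P (t + 1)) (hybrid P t) = expCondTV P t := by
  have hfac : ∀ y, |hybrid P (t + 1) y - hybrid P t y| =
      |prefProb P ((t : ℕ) + 1) y - prefProb P t y * marg P t (y t)| *
        ∏ i ∈ univ.filter (fun i : Fin k => ¬ (i : ℕ) < t + 1), marg P i (y i) := fun y => by
    rw [hybrid_eq, hybrid, ← sub_mul, abs_mul,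
      abs_of_nonneg (Finset.prod_nonneg fun i _ => marg_nonneg hP0 i (y i))]
  have hdep : ∀ y z : Fin k → V, (∀ i : Fin k, (i : ℕ) < t + 1 → y i = z i) →
      |prefProb P ((t : ℕ) + 1) y - prefProb P t y * marg P t (y t)| =
        |prefProb P ((t : ℕ) + 1) z - prefProb P t z * marg P t (z t)| := fun y z h => by
    rw [prefProb_congr P h, prefProb_congr P fun i hi => h i (Nat.lt_succ_of_lt hi),
      h t (Nat.lt_succ_self _)]
  rw [tv, Finset.sum_congr rfl fun y _ => hfac y,
    sum_mul_prod_tail t.2 _ (fun i => (sum_marg P i).trans hP1) _ hdep,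
    ← (Fin.snocEquiv fun _ : Fin ((t : ℕ) + 1) => V).sum_comp, Fintype.sum_prod_type_right,
    Finset.mul_sum]
  refine Finset.sum_congr rfl fun h _ => ?_
  rw [prefProb_mul_tv_condD hP0]
  congr 1
  refine Finset.sum_congr rfl fun v _ => ?_
  change |prefProb P _ (extendHist (Fin.snoc h v : Fin ((t : ℕ) + 1) → V)) -
    prefProb P _ (extendHist (Fin.snoc h v : Fin ((t : ℕ) + 1) → V)) *
      marg P t ((extendHist (Fin.snoc h v : Fin ((t : ℕ) + 1) → V) : Fin k → V) t)| = _
  rw [extendHist_snoc, Function.update_self]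
  congr 3
  exact prefProb_congr P fun i hi =>
    Function.update_of_ne (fun hit => by simp [hit] at hi) _ _

end MassFunction

theorem tv_self {X : Type*} [Fintype X] (p : X → ℝ) : tv p p = 0 := by simp [tv]

theorem tv_triangle {X : Type*} [Fintype X] (p q r : X → ℝ) : tv p r ≤ tv p q + tv q r := by
  unfold tv
  rw [← mul_add, ← Finset.sum_add_distrib]
  gcongr
  exact abs_sub_le _ _ _

theorem tv_le_sum_Ico {X : Type*} [Fintype X] (H : ℕ → X → ℝ) {a b : ℕ} (hab : a ≤ b) :
    tv (H b) (H a) ≤ ∑ s ∈ Finset.Ico a b, tv (H (s + 1)) (H s) := by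
  induction b, hab using Nat.le_induction with
  | base => simp [tv_self]
  | succ b hab ih =>
    rw [Finset.sum_Ico_succ_top hab]
    linarith [tv_triangle (H (b + 1)) (H b) (H a)]

/-- core inequality in the proof of Theorem 1. The total variation
distance between the joint distribution and the product of its marginals is at most
the sum, over positions `t` with a nonempty history (0-indexed `1 ≤ t`, i.e.
`t ∈ {2,…,k}` in the paper's 1-indexed notation), of the expected (over histories
drawn from `P`) total variation distance between the conditional distribution of the
`t`-th coordinate given its history and the `t`-th marginal. -/
theorem stmt3 {V : Type*} [Fintype V] [DecidableEq V] [Nonempty V] {k : ℕ} (hk : 1 ≤ k)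
    (P : (Fin k → V) → ℝ) (hP0 : ∀ y, 0 ≤ P y) (hP1 : ∑ y, P y = 1) :
    tv P (fun y => ∏ t, marg P t (y t)) ≤
      ∑ t ∈ univ.filter (fun t : Fin k => 1 ≤ (t : ℕ)), expCondTV P t := by
  have h := tv_le_sum_Ico (hybrid P) hk
  rw [hybrid_length, hybrid_one P hk] at h
  refine h.trans_eq ?_
  have hIco : Finset.Ico 1 k = (Finset.range k).filter (fun s => 1 ≤ s) := by
    ext s
    simp [and_comm]
  rw [hIco, Finset.sum_filter, Finset.sum_filter, Finset.sum_range]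
  refine Finset.sum_congr rfl fun t _ => ?_
  rw [tv_hybrid_succ hP0 hP1]
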